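/- arXiv:2507.13059 — 9 statements merged into one kernel-verified Lean document; each statement's English description precedes it below -/
import Mathlib

section
/- Let G be a finite simple connected graph on n vertices with degree d_i at each vertex i. Then ∑_{i} (1/d_i) ∑_{j ~ i} d_j = ∑_{i} d_i holds if and only if G is regular, i.e., there exists k such that d_i = k for every vertex i. -/
namespace SimpleGraph

theorem Connected.exists_forall_eq_of_adj {V α : Type*} {G : SimpleGraph V}
    (hG : G.Connected) {f : V → α} (hf : ∀ i j, G.Adj i j → f i = f j) : ∃ a, ∀ i, f i = a := by
  obtain ⟨v⟩ := hG.nonempty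
  refine ⟨f v, fun i => ?_⟩
  obtain ⟨p⟩ := hG.preconnected i v
  induction p with
  | nil => rfl
  | cons h _ ih => exact (hf _ _ h).trans ih

variable {V : Type*} [Fintype V] (G : SimpleGraph V) [DecidableRel G.Adj]

theorem sum_sum_neighborFinset_swap {M : Type*} [AddCommMonoid M] (f : V → V → M) :
    ∑ i, ∑ j ∈ G.neighborFinset i, f i j = ∑ i, ∑ j ∈ G.neighborFinset i, f j i :=
  Finset.sum_comm' fun i j => by simp [G.adj_comm]

/-- Twice the gap in the friendship paradox is a sum of squared degree differences over darts,
each divided by the product of the two degrees. -/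
theorem sum_sum_sq_degree_sub_div (hdeg : ∀ i, 0 < G.degree i) :
    ∑ i, ∑ j ∈ G.neighborFinset i,
        ((G.degree i : ℝ) - G.degree j) ^ 2 / (G.degree i * G.degree j) =
      2 * (∑ i, (1 / (G.degree i : ℝ)) * ∑ j ∈ G.neighborFinset i, (G.degree j : ℝ) -
        ∑ i, (G.degree i : ℝ)) := by
  have hpos (i : V) : (G.degree i : ℝ) ≠ 0 := by exact_mod_cast (hdeg i).ne'
  have hsplit (i j : V) : ((G.degree i : ℝ) - G.degree j) ^ 2 / (G.degree i * G.degree j) =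
      1 / (G.degree i : ℝ) * G.degree j + 1 / (G.degree j : ℝ) * G.degree i - 2 := by
    have := hpos i
    have := hpos j
    field_simp
    ring
  have hswap := G.sum_sum_neighborFinset_swap
    fun i j => 1 / (G.degree j : ℝ) * (G.degree i : ℝ)
  simp only [hsplit, Finset.sum_sub_distrib, Finset.sum_add_distrib, hswap, Finset.mul_sum,
    Finset.sum_const, card_neighborFinset_eq_degree, nsmul_eq_mul, ← Finset.sum_mul _ _ (2 : ℝ)]
  ring

end SimpleGraph

/-- For a finite simple connected graph `G` on `n` vertices (with all degrees positive),
equality `∑ᵢ (1/dᵢ) ∑_{j ~ i} dⱼ = ∑ᵢ dᵢ` holds in the friendship paradox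
if and only if `G` is regular. -/
theorem friendship_paradox_eq_iff_regular {n : ℕ} (G : SimpleGraph (Fin n))
    [DecidableRel G.Adj] (hconn : G.Connected) (hdeg : ∀ i, 0 < G.degree i) :
    (∑ i, (1 / (G.degree i : ℝ)) * ∑ j ∈ G.neighborFinset i, (G.degree j : ℝ) =
      ∑ i, (G.degree i : ℝ)) ↔ ∃ k : ℕ, ∀ i, G.degree i = k := by
  have key := G.sum_sum_sq_degree_sub_div hdeg
  constructor
  · intro h
    rw [h, sub_self, mul_zero] at key
    have hnn (i j : Fin n) :
        0 ≤ ((G.degree i : ℝ) - G.degree j) ^ 2 / (G.degree i * G.degree j) := by positivity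
    refine hconn.exists_forall_eq_of_adj fun i j hij => ?_
    have hi := (Finset.sum_eq_zero_iff_of_nonneg fun i _ =>
      Finset.sum_nonneg fun j _ => hnn i j).1 key i (Finset.mem_univ i)
    have hj := (Finset.sum_eq_zero_iff_of_nonneg fun j _ => hnn i j).1 hi j (by simpa using hij)
    simpa [(hdeg i).ne', (hdeg j).ne', sub_eq_zero] using hj
  · rintro ⟨k, hk⟩
    simp only [hk, sub_self, ne_eq, OfNat.ofNat_ne_zero, not_false_eq_true, zero_pow, zero_div,
      Finset.sum_const_zero] at key ⊢
    linarith
end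

section
/- Let G be a finite simple connected graph on n vertices with adjacency matrix A and degrees d_i = ∑_j A_{ij} > 0. Let r be an entrywise positive vector with ∑_i r_i = 1 satisfying A r = λ r for some λ > 0 (an eigenvector centrality). Then ∑_i r_i / d_i ≥ 1/λ; equivalently, ∑_i (1/d_i) ∑_j A_{ij} r_j ≥ ∑_i r_i, i.e., the centrality paradox holds for eigenvector centrality. -/
/-- **Centrality paradox for eigenvector centrality.** If `r > 0`, `∑ᵢ rᵢ = 1` and
`A r = λ r` with `λ > 0` for the adjacency matrix `A` of a connected simple graph with
positive degrees `d`, then `∑ᵢ rᵢ/dᵢ ≥ 1/λ`; equivalently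
`∑ᵢ (1/dᵢ) ∑ⱼ Aᵢⱼ rⱼ ≥ ∑ᵢ rᵢ`. -/
theorem centrality_paradox_eigenvector {n : ℕ} (G : SimpleGraph (Fin n))
    [DecidableRel G.Adj] (hconn : G.Connected)
    (A : Matrix (Fin n) (Fin n) ℝ) (hA : A = G.adjMatrix ℝ)
    (d : Fin n → ℝ) (hd : ∀ i, d i = ∑ j, A i j) (hdpos : ∀ i, 0 < d i)
    (r : Fin n → ℝ) (hrpos : ∀ i, 0 < r i) (hrsum : ∑ i, r i = 1)
    (lam : ℝ) (hlam : 0 < lam) (heig : A.mulVec r = lam • r) :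
    (∑ i, r i / d i ≥ 1 / lam) ∧
    (∑ i, (1 / d i) * ∑ j, A i j * r j ≥ ∑ i, r i) := by
  have hrow : ∀ i, ∑ j, A i j * r j = lam * r i := fun i => by
    simpa [Matrix.mulVec, dotProduct] using congrFun heig i
  have hsymm : ∀ i j, A i j = A j i := fun i j => by
    subst hA
    exact (G.isSymm_adjMatrix.apply i j).symm
  have hmean : ∑ i, r i * d i = lam :=
    calc ∑ i, r i * d i = ∑ i, ∑ j, A j i * r i := by
          refine Finset.sum_congr rfl fun i _ => ?_
          rw [hd, Finset.mul_sum]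
          exact Finset.sum_congr rfl fun j _ => by rw [hsymm i j, mul_comm]
      _ = ∑ j, lam * r j := by
          rw [Finset.sum_comm]
          exact Finset.sum_congr rfl fun j _ => hrow j
      _ = lam := by rw [← Finset.mul_sum, hrsum, mul_one]
  have hbound : 1 / lam ≤ ∑ i, r i / d i := by
    have h := Finset.sum_sq_le_sum_mul_sum_of_sq_le_mul Finset.univ
      (fun i _ => (div_pos (hrpos i) (hdpos i)).le)
      (fun i _ => (mul_pos (hrpos i) (hdpos i)).le)
      (r := r) fun i _ => by
        have := (hdpos i).ne'
        exact le_of_eq (by field_simp)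
    rw [hrsum, hmean, one_pow] at h
    exact (div_le_iff₀ hlam).2 h
  refine ⟨hbound, ?_⟩
  have hsum : ∑ i, (1 / d i) * ∑ j, A i j * r j = (∑ i, r i / d i) * lam := by
    rw [Finset.sum_mul]
    exact Finset.sum_congr rfl fun i _ => by rw [hrow]; ring
  rw [hsum, hrsum]
  exact (div_le_iff₀ hlam).1 hbound
end

section
/- Let G be a finite simple connected graph on n vertices with adjacency matrix A and degrees d_i = ∑_j A_{ij} > 0, and let r be an entrywise positive vector with ∑_i r_i = 1 satisfying A r = λ r for some λ > 0. If G is not regular (i.e., not all d_i are equal), then the inequality is strict: ∑_i r_i / d_i > 1/λ. -/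
/-- Strict weighted AM-HM inequality: for positive weights summing to one, the reciprocal of the
weighted mean of a nonconstant positive family is less than the weighted mean of reciprocals. -/
theorem inv_weighted_sum_lt_weighted_sum_inv {ι : Type*} [Fintype ι] (w x : ι → ℝ)
    (hw : ∀ i, 0 < w i) (hsum : ∑ i, w i = 1) (hx : ∀ i, 0 < x i)
    (hne : ¬ ∀ i j, x i = x j) :
    1 / ∑ i, w i * x i < ∑ i, w i / x i := by
  set m := ∑ i, w i * x i with hm
  obtain ⟨k, hk⟩ : ∃ k, x k ≠ m := by
    by_contra! h
    exact hne fun i j => (h i).trans (h j).symm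
  have hmpos : 0 < m := Finset.sum_pos (fun i _ => mul_pos (hw i) (hx i)) ⟨k, Finset.mem_univ k⟩
  have hpos : 0 < ∑ i, w i * (x i - m) ^ 2 / x i :=
    Finset.sum_pos' (fun i _ => div_nonneg (mul_nonneg (hw i).le (sq_nonneg _)) (hx i).le)
      ⟨k, Finset.mem_univ k,
        div_pos (mul_pos (hw k) (sq_pos_of_ne_zero (sub_ne_zero.mpr hk))) (hx k)⟩
  have hexpand : ∑ i, w i * (x i - m) ^ 2 / x i = m * (m * ∑ i, w i / x i - 1) := by
    calc ∑ i, w i * (x i - m) ^ 2 / x i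
        = ∑ i, (w i * x i - 2 * m * w i + m ^ 2 * (w i / x i)) :=
          Finset.sum_congr rfl fun i _ => by
            have := (hx i).ne'
            field_simp
            ring
      _ = m - 2 * m * 1 + m ^ 2 * ∑ i, w i / x i := by
          rw [Finset.sum_add_distrib, Finset.sum_sub_distrib, ← Finset.mul_sum, ← Finset.mul_sum,
            hsum, ← hm]
      _ = m * (m * ∑ i, w i / x i - 1) := by ring
  rw [hexpand] at hpos
  rw [div_lt_iff₀' hmpos]
  linarith [pos_of_mul_pos_right hpos hmpos.le]

/-- Strict centrality paradox for eigenvector centrality: under the same hypotheses as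
the eigenvector centrality paradox, if the graph is not regular (not all degrees are
equal) then `∑ᵢ rᵢ/dᵢ > 1/λ`. -/
theorem centrality_paradox_eigenvector_strict {n : ℕ} (G : SimpleGraph (Fin n))
    [DecidableRel G.Adj] (hconn : G.Connected)
    (A : Matrix (Fin n) (Fin n) ℝ) (hA : A = G.adjMatrix ℝ)
    (d : Fin n → ℝ) (hd : ∀ i, d i = ∑ j, A i j) (hdpos : ∀ i, 0 < d i)
    (r : Fin n → ℝ) (hrpos : ∀ i, 0 < r i) (hrsum : ∑ i, r i = 1)
    (lam : ℝ) (hlam : 0 < lam) (heig : A.mulVec r = lam • r)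
    (hnonreg : ¬ ∀ i j, d i = d j) :
    ∑ i, r i / d i > 1 / lam := by
  have hsymm : ∀ i j, A i j = A j i := fun i j => by
    simp [hA, SimpleGraph.adjMatrix_apply, G.adj_comm i j]
  have hmean : ∑ i, r i * d i = lam := by
    calc ∑ i, r i * d i = ∑ i, ∑ j, r i * A i j := by simp_rw [hd, Finset.mul_sum]
      _ = ∑ j, ∑ i, A j i * r i := by
        rw [Finset.sum_comm]
        exact Finset.sum_congr rfl fun j _ => Finset.sum_congr rfl fun i _ => by
          rw [hsymm i j, mul_comm]
      _ = ∑ j, lam * r j := Finset.sum_congr rfl fun j _ => congrFun heig j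
      _ = lam := by rw [← Finset.mul_sum, hrsum, mul_one]
  exact hmean ▸ inv_weighted_sum_lt_weighted_sum_inv r d hrpos hrsum hdpos hnonreg
end

section
/- Let W be a real n×n symmetric matrix with nonnegative entries which is irreducible, in the sense that for all indices i, j there exists k ≥ 1 with (W^k)_{ij} > 0, and let x ∈ ℝ^n be an entrywise positive vector. Then ∑_{i,j} (x_i / x_j) W_{ij} = ∑_{i,j} W_{ij} holds if and only if all the coordinates x_i are equal. -/
/-- A function which is constant along the nonzero entries of a matrix is constant along the
nonzero entries of each of its powers. -/
theorem Matrix.eq_of_pow_apply_ne_zero {ι R α : Type*} [Fintype ι] [DecidableEq ι] [Semiring R]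
    {A : Matrix ι ι R} {f : ι → α} (hf : ∀ i j, A i j ≠ 0 → f i = f j) (k : ℕ) {i j : ι}
    (hij : (A ^ k) i j ≠ 0) : f i = f j := by
  induction k generalizing j with
  | zero =>
    rw [pow_zero] at hij
    by_contra hne
    exact hij (Matrix.one_apply_ne fun h => hne (congrArg f h))
  | succ k ih =>
    rw [pow_succ, Matrix.mul_apply] at hij
    obtain ⟨l, -, hl⟩ := Finset.exists_ne_zero_of_sum_ne_zero hij
    exact (ih (left_ne_zero_of_mul hl)).trans (hf l j (right_ne_zero_of_mul hl))

/-- For symmetric `W`, twice the excess of `∑ᵢⱼ (xᵢ/xⱼ) Wᵢⱼ` over `∑ᵢⱼ Wᵢⱼ` is a weighted sum of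
squares. -/
theorem Matrix.two_mul_sum_ratio_sub_sum {ι K : Type*} [Fintype ι] [Field K]
    {W : Matrix ι ι K} (hsymm : ∀ i j, W i j = W j i) {x : ι → K} (hx : ∀ i, x i ≠ 0) :
    2 * (∑ i, ∑ j, (x i / x j) * W i j - ∑ i, ∑ j, W i j) =
      ∑ i, ∑ j, (x i - x j) ^ 2 / (x i * x j) * W i j := by
  have hswap : ∑ i, ∑ j, (x i / x j) * W i j = ∑ i, ∑ j, (x j / x i) * W i j := by
    rw [Finset.sum_comm]
    simp only [hsymm]
  have hterm (i j : ι) : (x i - x j) ^ 2 / (x i * x j) * W i j =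
      (x i / x j) * W i j + (x j / x i) * W i j - 2 * W i j := by
    have hi := hx i
    have hj := hx j
    field_simp
    ring
  simp only [hterm, Finset.sum_sub_distrib, Finset.sum_add_distrib, ← Finset.mul_sum, ← hswap]
  ring

/-- For a real symmetric, nonnegative, irreducible matrix `W` (for all `i, j` there is
`k ≥ 1` with `(W^k)ᵢⱼ > 0`) and an entrywise positive vector `x`, equality
`∑ᵢⱼ (xᵢ/xⱼ) Wᵢⱼ = ∑ᵢⱼ Wᵢⱼ` holds if and only if all coordinates of `x` are equal. -/
theorem sum_ratio_eq_sum_iff_const {n : ℕ} (W : Matrix (Fin n) (Fin n) ℝ)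
    (hsymm : ∀ i j, W i j = W j i) (hnonneg : ∀ i j, 0 ≤ W i j)
    (hirr : ∀ i j, ∃ k : ℕ, 1 ≤ k ∧ 0 < (W ^ k) i j)
    (x : Fin n → ℝ) (hx : ∀ i, 0 < x i) :
    (∑ i, ∑ j, (x i / x j) * W i j = ∑ i, ∑ j, W i j) ↔ ∀ i j, x i = x j := by
  constructor
  · intro h
    have hsum := Matrix.two_mul_sum_ratio_sub_sum hsymm fun i => (hx i).ne'
    rw [h, sub_self, mul_zero] at hsum
    have hterm (i j : Fin n) : 0 ≤ (x i - x j) ^ 2 / (x i * x j) * W i j :=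
      mul_nonneg (div_nonneg (sq_nonneg _) (mul_pos (hx i) (hx j)).le) (hnonneg i j)
    have hedge (i j : Fin n) (hW : W i j ≠ 0) : x i = x j := by
      have hi := (Finset.sum_eq_zero_iff_of_nonneg fun i _ =>
        Finset.sum_nonneg fun j _ => hterm i j).1 hsum.symm i (Finset.mem_univ i)
      have hj := (Finset.sum_eq_zero_iff_of_nonneg fun j _ => hterm i j).1 hi j
        (Finset.mem_univ j)
      simpa [hW, (hx i).ne', (hx j).ne', sub_eq_zero] using hj
    intro i j
    obtain ⟨k, -, hk⟩ := hirr i j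
    exact Matrix.eq_of_pow_apply_ne_zero hedge k hk.ne'
  · intro h
    refine Finset.sum_congr rfl fun i _ => Finset.sum_congr rfl fun j _ => ?_
    rw [h i j, div_self (hx j).ne', one_mul]
end

section
/- Let G be a finite simple connected graph on n vertices with adjacency matrix A and degrees d_i = ∑_j A_{ij} > 0, and let ℓ ≥ 0 be an integer. Then ∑_i (1/d_i) (A^{ℓ+1} 𝟙)_i ≥ ∑_i (A^ℓ 𝟙)_i, where 𝟙 is the all-ones vector; i.e., the centrality paradox holds for the walk-count centrality r = A^ℓ 𝟙 counting walks of length ℓ from each vertex. -/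
/-- For a symmetric matrix with nonnegative entries, weighting the entries by the ratios
`d j / d i` of a positive vector does not decrease their sum. -/
theorem Matrix.IsSymm.sum_le_sum_mul_div {ι : Type*} [Fintype ι] {M : Matrix ι ι ℝ}
    (hM : M.IsSymm) (hM0 : ∀ i j, 0 ≤ M i j) {d : ι → ℝ} (hd : ∀ i, 0 < d i) :
    ∑ i, ∑ j, M i j ≤ ∑ i, ∑ j, M i j * (d j / d i) := by
  have hswap : ∑ i, ∑ j, M i j * (d j / d i) = ∑ i, ∑ j, M i j * (d i / d j) := by
    rw [Finset.sum_comm]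
    exact Finset.sum_congr rfl fun i _ => Finset.sum_congr rfl fun j _ => by rw [hM.apply]
  have hratio (i j : ι) : 2 ≤ d j / d i + d i / d j := by
    have hi := hd i
    have hj := hd j
    rw [div_add_div _ _ hi.ne' hj.ne', le_div_iff₀ (mul_pos hi hj)]
    nlinarith [sq_nonneg (d i - d j)]
  have hsum : ∑ i, ∑ j, M i j * 2 ≤
      ∑ i, ∑ j, (M i j * (d j / d i) + M i j * (d i / d j)) := by
    refine Finset.sum_le_sum fun i _ => Finset.sum_le_sum fun j _ => ?_
    rw [← mul_add]
    exact mul_le_mul_of_nonneg_left (hratio i j) (hM0 i j)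
  simp only [Finset.sum_add_distrib, ← Finset.sum_mul] at hsum
  linarith

/-- Powers of a matrix with nonnegative entries have nonnegative entries. -/
theorem Matrix.pow_apply_nonneg_of_nonneg {ι : Type*} [Fintype ι] [DecidableEq ι]
    {A : Matrix ι ι ℝ} (hA : ∀ i j, 0 ≤ A i j) (k : ℕ) (i j : ι) : 0 ≤ (A ^ k) i j := by
  induction k generalizing i j with
  | zero =>
    rw [pow_zero, Matrix.one_apply]
    split_ifs <;> norm_num
  | succ k ih =>
    rw [pow_succ, Matrix.mul_apply]
    exact Finset.sum_nonneg fun l _ => mul_nonneg (ih i l) (hA l j)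


/-- **Centrality paradox for walk-count centrality.** For a connected simple graph with
adjacency matrix `A`, positive degrees `d`, and any `ℓ ≥ 0`,
`∑ᵢ (1/dᵢ)(A^{ℓ+1} 𝟙)ᵢ ≥ ∑ᵢ (A^ℓ 𝟙)ᵢ`. -/
theorem centrality_paradox_walk_count {n : ℕ} (G : SimpleGraph (Fin n))
    [DecidableRel G.Adj] (hconn : G.Connected)
    (A : Matrix (Fin n) (Fin n) ℝ) (hA : A = G.adjMatrix ℝ)
    (d : Fin n → ℝ) (hd : ∀ i, d i = ∑ j, A i j) (hdpos : ∀ i, 0 < d i)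
    (ℓ : ℕ) :
    ∑ i, (1 / d i) * (A ^ (ℓ + 1)).mulVec 1 i ≥ ∑ i, (A ^ ℓ).mulVec 1 i := by
  have hsymm : (A ^ ℓ).IsSymm := by
    rw [Matrix.IsSymm, Matrix.transpose_pow, hA, SimpleGraph.transpose_adjMatrix]
  have hnonneg : ∀ i j, 0 ≤ A i j := by
    intro i j
    rw [hA, SimpleGraph.adjMatrix_apply]
    split_ifs <;> norm_num
  have hd' : A.mulVec 1 = d := by
    ext i
    simp [Matrix.mulVec, dotProduct, hd]
  have hleft (i : Fin n) : (A ^ ℓ).mulVec 1 i = ∑ j, (A ^ ℓ) i j := by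
    simp [Matrix.mulVec, dotProduct]
  have hright (i : Fin n) : (1 / d i) * (A ^ (ℓ + 1)).mulVec 1 i =
      ∑ j, (A ^ ℓ) i j * (d j / d i) := by
    rw [pow_succ, ← Matrix.mulVec_mulVec, hd', Matrix.mulVec, dotProduct, Finset.mul_sum]
    exact Finset.sum_congr rfl fun j _ => by ring
  simp only [hleft, hright]
  exact hsymm.sum_le_sum_mul_div (Matrix.pow_apply_nonneg_of_nonneg hnonneg ℓ) hdpos
end

section
/- Let G be a finite simple connected graph on n vertices with adjacency matrix A and degrees d_i = ∑_j A_{ij} > 0. Let α > 0 be such that for each vertex i the series ∑_{ℓ=0}^∞ α^ℓ (A^ℓ 𝟙)_i is summable, and define the Katz centrality r_i = ∑_{ℓ=0}^∞ α^ℓ (A^ℓ 𝟙)_i. Then ∑_i (1/d_i) ∑_j A_{ij} r_j ≥ ∑_i r_i; i.e., the centrality paradox holds for Katz centrality. -/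
open Matrix in
/-- A symmetric nonnegative matrix `B` and a positive vector `d` satisfy
`∑ᵢⱼ Bᵢⱼ ≤ ∑ᵢ (1/dᵢ) ∑ⱼ Bᵢⱼ dⱼ`. -/
theorem Matrix.IsSymm.sum_mulVec_one_le {ι : Type*} [Fintype ι] {B : Matrix ι ι ℝ}
    (hB : B.IsSymm) (hB0 : ∀ i j, 0 ≤ B i j) {d : ι → ℝ} (hd : ∀ i, 0 < d i) :
    ∑ i, (B *ᵥ 1) i ≤ ∑ i, (1 / d i) * (B *ᵥ d) i := by
  have hexp : ∑ i, (1 / d i) * (B *ᵥ d) i = ∑ i, ∑ j, B i j * (d j / d i) := by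
    refine Finset.sum_congr rfl fun i _ => ?_
    rw [mulVec, dotProduct, Finset.mul_sum]
    exact Finset.sum_congr rfl fun j _ => by ring
  have hswap : ∑ i, ∑ j, B i j * (d j / d i) = ∑ i, ∑ j, B i j * (d i / d j) := by
    rw [Finset.sum_comm]
    simp only [hB.apply]
  have hpair : ∀ i j, 2 ≤ d j / d i + d i / d j := fun i j => by
    have hi := hd i
    have hj := hd j
    rw [div_add_div _ _ hi.ne' hj.ne', le_div_iff₀ (mul_pos hi hj)]
    nlinarith [sq_nonneg (d i - d j)]
  have hle : ∑ i, ∑ j, B i j * 2 ≤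
      ∑ i, ∑ j, (B i j * (d j / d i) + B i j * (d i / d j)) := by
    gcongr with i _ j _
    rw [← mul_add]
    exact mul_le_mul_of_nonneg_left (hpair i j) (hB0 i j)
  simp only [Finset.sum_add_distrib, ← Finset.sum_mul, ← hswap] at hle
  rw [hexp]
  simp only [mulVec, dotProduct, Pi.one_apply, mul_one]
  linarith

/-- **Centrality paradox for Katz centrality.** For a connected simple graph with
adjacency matrix `A`, positive degrees `d`, and `α > 0` such that the Katz series
`rᵢ = ∑_{ℓ=0}^∞ αℓ (A^ℓ 𝟙)ᵢ` is summable at each vertex,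
`∑ᵢ (1/dᵢ) ∑ⱼ Aᵢⱼ rⱼ ≥ ∑ᵢ rᵢ`. -/
theorem centrality_paradox_katz {n : ℕ} (G : SimpleGraph (Fin n))
    [DecidableRel G.Adj] (hconn : G.Connected)
    (A : Matrix (Fin n) (Fin n) ℝ) (hA : A = G.adjMatrix ℝ)
    (d : Fin n → ℝ) (hd : ∀ i, d i = ∑ j, A i j) (hdpos : ∀ i, 0 < d i)
    (α : ℝ) (hα : 0 < α)
    (hsum : ∀ i, Summable fun ℓ : ℕ => α ^ ℓ * (A ^ ℓ).mulVec 1 i)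
    (r : Fin n → ℝ) (hr : ∀ i, r i = ∑' ℓ : ℕ, α ^ ℓ * (A ^ ℓ).mulVec 1 i) :
    ∑ i, (1 / d i) * ∑ j, A i j * r j ≥ ∑ i, r i := by
  have hA0 : ∀ i j, 0 ≤ A i j := fun i j => by
    rw [hA, SimpleGraph.adjMatrix_apply]
    split_ifs <;> norm_num
  have hAsymm : A.IsSymm := hA ▸ G.isSymm_adjMatrix
  have hd_eq : d = A.mulVec 1 := by
    ext i
    simp [hd, Matrix.mulVec, dotProduct]
  have hrsum : ∀ i, HasSum (fun ℓ : ℕ => α ^ ℓ * (A ^ ℓ).mulVec 1 i) (r i) := fun i =>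
    hr i ▸ (hsum i).hasSum
  refine ge_iff_le.mpr <| hasSum_le (fun ℓ => ?_) (hasSum_sum fun i _ => hrsum i)
    (hasSum_sum fun i _ => (hasSum_sum fun j _ => (hrsum j).mul_left (A i j)).mul_left (1 / d i))
  have hterm : ∀ i, ∑ j, A i j * (α ^ ℓ * (A ^ ℓ).mulVec 1 j) =
      α ^ ℓ * (A ^ ℓ).mulVec d i := fun i => by
    rw [hd_eq, Matrix.mulVec_mulVec, ← pow_succ, pow_succ', ← Matrix.mulVec_mulVec,
      Matrix.mulVec, dotProduct, Finset.mul_sum]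
    exact Finset.sum_congr rfl fun j _ => by ring
  simp only [hterm]
  simp only [mul_left_comm _ (α ^ ℓ), ← Finset.mul_sum]
  exact mul_le_mul_of_nonneg_left
    ((hAsymm.pow ℓ).sum_mulVec_one_le (Matrix.pow_apply_nonneg hA0 ℓ) hdpos) (by positivity)
end

section
/- Let P be a real n×n matrix with nonnegative entries, let λ ∈ ℝ, and let u, v ∈ ℝ^n be entrywise positive vectors with P u = λ u, vᵀ P = λ vᵀ, and vᵀ u = 1. Then for any entrywise positive vectors x, y ∈ ℝ^n satisfying x_i y_i = u_i v_i for every i, one has yᵀ P x ≥ vᵀ P u = λ. -/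
open Matrix

/-- For `x = u * exp w` and `y = v * exp (-w)`, the bilinear form of a nonnegative matrix is bounded
below by its first-order expansion in `w`. -/
theorem dotProduct_mulVec_exp_ge {ι : Type*} [Fintype ι] (P : Matrix ι ι ℝ)
    (hP : ∀ i j, 0 ≤ P i j) (u v w : ι → ℝ) (hu : ∀ i, 0 ≤ u i) (hv : ∀ i, 0 ≤ v i) :
    v ⬝ᵥ P *ᵥ u + v ⬝ᵥ P *ᵥ (fun i => u i * w i) - (fun i => v i * w i) ⬝ᵥ P *ᵥ u ≤
      (fun i => v i * Real.exp (-w i)) ⬝ᵥ P *ᵥ (fun i => u i * Real.exp (w i)) := by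
  simp only [dotProduct, mulVec, Finset.mul_sum, ← Finset.sum_add_distrib,
    ← Finset.sum_sub_distrib]
  refine Finset.sum_le_sum fun i _ => Finset.sum_le_sum fun j _ => ?_
  calc
    _ = v i * P i j * u j * (w j - w i + 1) := by ring
    _ ≤ v i * P i j * u j * Real.exp (w j - w i) :=
      mul_le_mul_of_nonneg_left (Real.add_one_le_exp _)
        (mul_nonneg (mul_nonneg (hv i) (hP i j)) (hu j))
    _ = _ := by
      rw [sub_eq_add_neg, Real.exp_add]
      ring

/-- **Fiedler's variational inequality.** Let `P` be a nonnegative real matrix with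
positive right/left eigenvectors `u, v` for the eigenvalue `λ`, normalized so that
`vᵀu = 1`. Then for any positive vectors `x, y` with `xᵢ yᵢ = uᵢ vᵢ` for every `i`,
`yᵀ P x ≥ vᵀ P u = λ`. -/
theorem fiedler_bilinear_inequality {n : ℕ} (P : Matrix (Fin n) (Fin n) ℝ)
    (hP : ∀ i j, 0 ≤ P i j) (lam : ℝ)
    (u v : Fin n → ℝ) (hu : ∀ i, 0 < u i) (hv : ∀ i, 0 < v i)
    (hPu : P.mulVec u = lam • u) (hvP : P.vecMul v = lam • v)
    (hnorm : v ⬝ᵥ u = 1)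
    (x y : Fin n → ℝ) (hx : ∀ i, 0 < x i) (hy : ∀ i, 0 < y i)
    (hxy : ∀ i, x i * y i = u i * v i) :
    y ⬝ᵥ P.mulVec x ≥ v ⬝ᵥ P.mulVec u ∧ v ⬝ᵥ P.mulVec u = lam := by
  have hlam : v ⬝ᵥ P.mulVec u = lam := by
    rw [hPu, dotProduct_smul, hnorm, smul_eq_mul, mul_one]
  refine ⟨?_, hlam⟩
  let w : Fin n → ℝ := fun i => Real.log (x i / u i)
  have hexp : ∀ i, Real.exp (w i) = x i / u i := fun i => Real.exp_log (div_pos (hx i) (hu i))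
  have hxw : x = fun i => u i * Real.exp (w i) := by
    funext i
    rw [hexp, mul_div_cancel₀ _ (hu i).ne']
  have hyw : y = fun i => v i * Real.exp (-w i) := by
    funext i
    rw [Real.exp_neg, hexp, inv_div, ← mul_div_assoc, eq_div_iff (hx i).ne']
    linarith [hxy i]
  have hcancel : v ⬝ᵥ P *ᵥ (fun i => u i * w i) = (fun i => v i * w i) ⬝ᵥ P *ᵥ u := by
    rw [dotProduct_mulVec, hvP, hPu, smul_dotProduct, dotProduct_smul]
    congr 1
    exact Finset.sum_congr rfl fun i _ => by ring
  have hge := dotProduct_mulVec_exp_ge P hP u v w (fun i => (hu i).le) (fun i => (hv i).le)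
  rw [← hxw, ← hyw, hcancel, add_sub_cancel_right] at hge
  exact hge
end

section
/- Let P be a real n×n matrix with nonnegative entries, let λ ∈ ℝ, and let u, v ∈ ℝ^n be entrywise positive vectors with P u = λ u, vᵀ P = λ vᵀ, and vᵀ u = 1. Then uᵀ P v ≥ vᵀ P u = λ. -/
open Matrix

/-- The entrywise tangent-line bound `1 + log x ≤ x` at `x = (a d) / (b c)`, cleared of
denominators and weighted by `p ≥ 0`. -/
lemma mul_add_mul_log_sub_le {p a b c d : ℝ} (hp : 0 ≤ p) (ha : 0 < a) (hb : 0 < b)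
    (hc : 0 < c) (hd : 0 < d) :
    b * p * c + b * p * c * (Real.log (a / b) - Real.log (c / d)) ≤ a * p * d := by
  rw [← Real.log_div (by positivity) (by positivity)]
  have h := Real.log_le_sub_one_of_pos (show 0 < a / b / (c / d) by positivity)
  calc b * p * c + b * p * c * Real.log (a / b / (c / d))
      ≤ b * p * c + b * p * c * (a / b / (c / d) - 1) := by gcongr
    _ = a * p * d := by field_simp; ring

/-- Special case of Fiedler's variational inequality: with `P` nonnegative, `u, v`
positive right/left eigenvectors for `λ` normalized so that `vᵀu = 1`, one has
`uᵀ P v ≥ vᵀ P u = λ`. -/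
theorem fiedler_swap_inequality {n : ℕ} (P : Matrix (Fin n) (Fin n) ℝ)
    (hP : ∀ i j, 0 ≤ P i j) (lam : ℝ)
    (u v : Fin n → ℝ) (hu : ∀ i, 0 < u i) (hv : ∀ i, 0 < v i)
    (hPu : P.mulVec u = lam • u) (hvP : P.vecMul v = lam • v)
    (hnorm : v ⬝ᵥ u = 1) :
    u ⬝ᵥ P.mulVec v ≥ v ⬝ᵥ P.mulVec u ∧ v ⬝ᵥ P.mulVec u = lam := by
  refine ⟨?_, by rw [hPu, dotProduct_smul, hnorm, smul_eq_mul, mul_one]⟩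
  have expand (x y : Fin n → ℝ) : x ⬝ᵥ P.mulVec y = ∑ i, ∑ j, x i * P i j * y j := by
    simp only [dotProduct, mulVec, Finset.mul_sum, mul_assoc]
  have hrow (i : Fin n) : ∑ j, v i * P i j * u j = lam * v i * u i := by
    have h := congrFun hPu i
    simp only [mulVec, dotProduct, Pi.smul_apply, smul_eq_mul] at h
    simp only [mul_assoc, ← Finset.mul_sum, h]
    ring
  have hcol (j : Fin n) : ∑ i, v i * P i j * u j = lam * v j * u j := by
    have h := congrFun hvP j
    simp only [vecMul, dotProduct, Pi.smul_apply, smul_eq_mul] at h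
    rw [← Finset.sum_mul, h]
  set r : Fin n → ℝ := fun i => Real.log (u i / v i)
  have hzero : ∑ i, ∑ j, v i * P i j * u j * (r i - r j) = 0 := by
    simp only [mul_sub, Finset.sum_sub_distrib]
    rw [Finset.sum_comm (f := fun i j => v i * P i j * u j * r j)]
    simp only [← Finset.sum_mul, hrow, hcol, sub_self]
  rw [ge_iff_le, expand, expand]
  calc ∑ i, ∑ j, v i * P i j * u j
      = ∑ i, ∑ j, (v i * P i j * u j + v i * P i j * u j * (r i - r j)) := by
        simp only [Finset.sum_add_distrib, hzero, add_zero]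
    _ ≤ ∑ i, ∑ j, u i * P i j * v j :=
        Finset.sum_le_sum fun i _ => Finset.sum_le_sum fun j _ =>
          mul_add_mul_log_sub_le (hP i j) (hu i) (hv i) (hu j) (hv j)
end

section
/- Let A be a real n×n matrix with entries in {0,1} (the adjacency matrix of a directed graph) such that every out-degree d_i^out = ∑_j A_{ij} is positive, and let C_{ij} = A_{ij}/d_i^out be the row-stochastic transition matrix. Fix β ∈ (0,1) and let P = (1−β) C + (β/n) 𝟙 𝟙ᵀ be the PageRank matrix. Let r ∈ ℝ^n be entrywise positive with ∑_i r_i = 1 and rᵀ P = rᵀ (the PageRank centrality). Then ∑_i (1/d_i^out) ∑_j A_{ij} r_j ≥ ∑_i r_i = 1; i.e., the centrality paradox holds for PageRank. -/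
/-- If `r` is a positive left fixed vector of a row-stochastic matrix `P`, then
`∑ᵢ rᵢ ≤ ∑ᵢ (P r)ᵢ`: apply `1 + log x ≤ x` to `x = rⱼ / rᵢ` and average with
weights `rᵢ Pᵢⱼ`. -/
theorem sum_le_sum_mulVec_of_vecMul_eq_self {ι : Type*} [Fintype ι] {P : Matrix ι ι ℝ}
    (hP0 : ∀ i j, 0 ≤ P i j) (hP1 : ∀ i, ∑ j, P i j = 1) {r : ι → ℝ}
    (hr : ∀ i, 0 < r i) (hrP : P.vecMul r = r) :
    ∑ i, r i ≤ ∑ i, ∑ j, P i j * r j := by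
  have hcol (j : ι) : ∑ i, r i * P i j = r j := congrFun hrP j
  have hterm (i j : ι) :
      r i * P i j + (r i * P i j * Real.log (r j) - r i * Real.log (r i) * P i j)
        ≤ P i j * r j := by
    have hlog := Real.log_le_sub_one_of_pos (div_pos (hr j) (hr i))
    rw [Real.log_div (hr j).ne' (hr i).ne'] at hlog
    have hmul := mul_le_mul_of_nonneg_left hlog (mul_nonneg (hr i).le (hP0 i j))
    have hcancel : r i * P i j * (r j / r i - 1) = P i j * r j - r i * P i j := by
      have := (hr i).ne'
      field_simp
    linarith
  have hsum := Finset.sum_le_sum fun i (_ : i ∈ Finset.univ) ↦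
    Finset.sum_le_sum fun j (_ : j ∈ Finset.univ) ↦ hterm i j
  have hright : ∑ i, ∑ j, r i * P i j * Real.log (r j) = ∑ j, r j * Real.log (r j) := by
    rw [Finset.sum_comm]
    simp only [← Finset.sum_mul, hcol]
  simp only [Finset.sum_add_distrib, Finset.sum_sub_distrib, hright, ← Finset.mul_sum, hP1,
    mul_one, sub_self, add_zero] at hsum
  exact hsum

/-- **Centrality paradox for PageRank (directed setting).** Let `A` be a 0–1 adjacency
matrix of a directed graph with positive out-degrees `d`, `C` the row-stochastic
transition matrix `Cᵢⱼ = Aᵢⱼ/dᵢ`, `β ∈ (0,1)`, and `P = (1-β)C + (β/n)𝟙𝟙ᵀ` the PageRank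
matrix. If `r > 0`, `∑ᵢ rᵢ = 1`, and `rᵀP = rᵀ`, then
`∑ᵢ (1/dᵢ) ∑ⱼ Aᵢⱼ rⱼ ≥ ∑ᵢ rᵢ`. -/
theorem centrality_paradox_pagerank {n : ℕ} (A : Matrix (Fin n) (Fin n) ℝ)
    (hA01 : ∀ i j, A i j = 0 ∨ A i j = 1)
    (d : Fin n → ℝ) (hd : ∀ i, d i = ∑ j, A i j) (hdpos : ∀ i, 0 < d i)
    (C : Matrix (Fin n) (Fin n) ℝ) (hC : ∀ i j, C i j = A i j / d i)
    (β : ℝ) (hβ : 0 < β ∧ β < 1)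
    (P : Matrix (Fin n) (Fin n) ℝ)
    (hP : ∀ i j, P i j = (1 - β) * C i j + β / n)
    (r : Fin n → ℝ) (hrpos : ∀ i, 0 < r i) (hrsum : ∑ i, r i = 1)
    (hrP : P.vecMul r = r) :
    ∑ i, (1 / d i) * ∑ j, A i j * r j ≥ ∑ i, r i := by
  obtain ⟨hβ0, hβ1⟩ := hβ
  have hn : (n : ℝ) ≠ 0 := by
    rintro h
    obtain rfl : n = 0 := by exact_mod_cast h
    simp at hrsum
  have hC0 (i j : Fin n) : 0 ≤ C i j := by
    rw [hC]
    rcases hA01 i j with h | h <;> simp [h, (hdpos i).le]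
  have hC1 (i : Fin n) : ∑ j, C i j = 1 := by
    simp only [hC]
    rw [← Finset.sum_div, ← hd, div_self (hdpos i).ne']
  have hP0 (i j : Fin n) : 0 ≤ P i j := by
    rw [hP]
    have := mul_nonneg (sub_nonneg.2 hβ1.le) (hC0 i j)
    positivity
  have hP1 (i : Fin n) : ∑ j, P i j = 1 := by
    simp only [hP, Finset.sum_add_distrib, ← Finset.mul_sum, hC1, Finset.sum_const,
      Finset.card_univ, Fintype.card_fin, nsmul_eq_mul, mul_div_cancel₀ _ hn]
    ring
  have hCr : ∑ i, (1 / d i) * ∑ j, A i j * r j = ∑ i, ∑ j, C i j * r j := by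
    simp only [Finset.mul_sum, hC]
    exact Finset.sum_congr rfl fun i _ ↦ Finset.sum_congr rfl fun j _ ↦ by ring
  have hPr : ∑ i, ∑ j, P i j * r j = (1 - β) * ∑ i, ∑ j, C i j * r j + β := by
    simp only [hP, add_mul, mul_assoc, Finset.sum_add_distrib, ← Finset.mul_sum, hrsum,
      Finset.sum_const, Finset.card_univ, Fintype.card_fin, nsmul_eq_mul]
    field_simp
  have hmain := sum_le_sum_mulVec_of_vecMul_eq_self hP0 hP1 hrpos hrP
  rw [hPr, hrsum] at hmain
  rw [hCr, hrsum]
  nlinarith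
end
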